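/- Let G be a connected vertex-transitive non-bipartite triangle-free simple graph of degree 5 and even order that is not 4-factor-critical, and suppose λ₆(G) ≥ 14 and λ₈(G) = 15. Then every λ₈-atom S of G satisfies |S| ≥ 15. -/

import Mathlib

open SimpleGraph

section Defs

variable {V : Type*}

/-- A simple graph is vertex-transitive if any vertex can be mapped to any other
by a graph automorphism. -/
def VertexTransitive (G : SimpleGraph V) : Prop :=
  ∀ x y : V, ∃ φ : G ≃g G, φ x = y

/-- A graph is `p`-factor-critical if the removal of any set of `p` vertices
results in a graph with a perfect matching. -/
def PFactorCritical (G : SimpleGraph V) (p : ℕ) : Prop :=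
  ∀ X : Set V, X.ncard = p → ∃ M : (G.induce Xᶜ).Subgraph, M.IsPerfectMatching

/-- A graph is factor-critical if the removal of any single vertex results in a
graph with a perfect matching. -/
def IsFactorCritical {W : Type*} (H : SimpleGraph W) : Prop :=
  ∀ v : W, ∃ M : (H.induce ({v}ᶜ : Set W)).Subgraph, M.IsPerfectMatching

/-- `∇(X)`: the set of edges of `G` with exactly one end in `X`. -/
def edgeBoundary (G : SimpleGraph V) (X : Set V) : Set (Sym2 V) :=
  {e | e ∈ G.edgeSet ∧ ∃ x ∈ X, ∃ y ∈ Xᶜ, e = s(x, y)}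

/-- The set of edges of `G` with both ends in `X`. -/
def edgesWithin (G : SimpleGraph V) (X : Set V) : Set (Sym2 V) :=
  {e | e ∈ G.edgeSet ∧ ∀ v ∈ e, v ∈ X}

/-- The set of edges of `G` with one end in `A` and the other end in `S \ A`
(i.e. the edge boundary of `A` inside the induced subgraph `G[S]` when `A ⊆ S`). -/
def inducedEdgeBoundary (G : SimpleGraph V) (S A : Set V) : Set (Sym2 V) :=
  {e | e ∈ G.edgeSet ∧ ∃ x ∈ A, ∃ y ∈ S \ A, e = s(x, y)}

/-- `F` is an `s`-restricted edge-cut of `G` if deleting `F` disconnects `G` and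
every component of `G − F` has at least `s` vertices. -/
def IsRestrictedEdgeCut (G : SimpleGraph V) (s : ℕ) (F : Set (Sym2 V)) : Prop :=
  F ⊆ G.edgeSet ∧ ¬ (G.deleteEdges F).Connected ∧
    ∀ c : (G.deleteEdges F).ConnectedComponent, s ≤ c.supp.ncard

/-- `λ_s(G)`: the minimum cardinality of an `s`-restricted edge-cut of `G`. -/
noncomputable def lambdaS (G : SimpleGraph V) (s : ℕ) : ℕ :=
  sInf (Set.ncard '' {F | IsRestrictedEdgeCut G s F})

/-- A `λ_s`-fragment: a vertex set whose edge boundary is an `s`-restricted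
edge-cut of minimum cardinality `λ_s(G)`. -/
def IsLambdaFragment (G : SimpleGraph V) (s : ℕ) (X : Set V) : Prop :=
  IsRestrictedEdgeCut G s (edgeBoundary G X) ∧ (edgeBoundary G X).ncard = lambdaS G s

/-- A `λ_s`-atom: a `λ_s`-fragment of minimum cardinality. -/
def IsLambdaAtom (G : SimpleGraph V) (s : ℕ) (X : Set V) : Prop :=
  IsLambdaFragment G s X ∧ ∀ Y : Set V, IsLambdaFragment G s Y → X.ncard ≤ Y.ncard

/-- The odd girth of `G`: the length of a shortest odd cycle of `G`. -/
noncomputable def oddGirth (G : SimpleGraph V) : ℕ :=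
  sInf {n | Odd n ∧ ∃ (v : V) (c : G.Walk v v), c.IsCycle ∧ c.length = n}

/-- `X` is an independent set of `G`. -/
def IsIndependentSet (G : SimpleGraph V) (X : Set V) : Prop :=
  ∀ x ∈ X, ∀ y ∈ X, ¬ G.Adj x y

/-- The independence number `α(G)`. -/
noncomputable def indepNum (G : SimpleGraph V) : ℕ :=
  sSup {n | ∃ X : Set V, IsIndependentSet G X ∧ X.ncard = n}

/-- The number of trivial (single-vertex) components of `G − X`. -/
noncomputable def trivialComponentCount (G : SimpleGraph V) (X : Set V) : ℕ :=
  {c : (G.induce Xᶜ).ConnectedComponent | c.supp.ncard = 1}.ncard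

/-- The number of odd components of `G − X`. -/
noncomputable def oddComponentCount (G : SimpleGraph V) (X : Set V) : ℕ :=
  {c : (G.induce Xᶜ).ConnectedComponent | Odd c.supp.ncard}.ncard

/-- The number of nontrivial components of `G − X`. -/
noncomputable def nontrivialComponentCount (G : SimpleGraph V) (X : Set V) : ℕ :=
  {c : (G.induce Xᶜ).ConnectedComponent | 2 ≤ c.supp.ncard}.ncard

/-- An imprimitive block of `G`: a proper non-empty vertex set that every
automorphism either fixes setwise or maps to a disjoint set. -/
def IsImprimitiveBlock (G : SimpleGraph V) (X : Set V) : Prop :=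
  X.Nonempty ∧ X ≠ Set.univ ∧ ∀ φ : G ≃g G, (⇑φ) '' X = X ∨ ((⇑φ) '' X) ∩ X = ∅

/-- A connected graph is `q`-extendable if it has a perfect matching and every
matching of size `q` is contained in a perfect matching. -/
def Extendable (G : SimpleGraph V) (q : ℕ) : Prop :=
  (∃ M : G.Subgraph, M.IsPerfectMatching) ∧
    ∀ M : G.Subgraph, M.IsMatching → M.edgeSet.ncard = q →
      ∃ P : G.Subgraph, P.IsPerfectMatching ∧ M ≤ P

end Defs


set_option linter.unusedSectionVars false

namespace FC

section Basic

variable {V : Type*} [Fintype V] [DecidableEq V] (G : SimpleGraph V) [DecidableRel G.Adj]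

/-- number of ordered adjacent pairs in `A × B`. -/
def ec (A B : Finset V) : ℕ := ∑ a ∈ A, ∑ b ∈ B, if G.Adj a b then 1 else 0

/-- size of the edge boundary -/
def bd (A : Finset V) : ℕ := ec G A Aᶜ

lemma ec_comm (A B : Finset V) : ec G A B = ec G B A := by
  unfold ec
  rw [Finset.sum_comm]
  simp [G.adj_comm]

lemma ec_union_left {A B : Finset V} (C : Finset V) (h : Disjoint A B) :
    ec G (A ∪ B) C = ec G A C + ec G B C := by
  unfold ec
  rw [Finset.sum_union h]

lemma ec_union_right {A B : Finset V} (C : Finset V) (h : Disjoint A B) :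
    ec G C (A ∪ B) = ec G C A + ec G C B := by
  rw [ec_comm, ec_union_left G C h, ec_comm, ec_comm G B]

lemma ec_empty_left (A : Finset V) : ec G ∅ A = 0 := by simp [ec]
lemma ec_empty_right (A : Finset V) : ec G A ∅ = 0 := by simp [ec]

lemma ec_eq_zero {A B : Finset V} : ec G A B = 0 ↔ ∀ a ∈ A, ∀ b ∈ B, ¬ G.Adj a b := by
  unfold ec
  rw [Finset.sum_eq_zero_iff]
  refine forall₂_congr fun a _ => ?_
  rw [Finset.sum_eq_zero_iff]
  refine forall₂_congr fun b _ => ?_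
  simp

lemma ec_mono {A B A' B' : Finset V} (h : A ⊆ A') (h' : B ⊆ B') : ec G A B ≤ ec G A' B' := by
  unfold ec
  calc _ ≤ ∑ a ∈ A, ∑ b ∈ B', (if G.Adj a b then 1 else 0) :=
        Finset.sum_le_sum fun a _ => Finset.sum_le_sum_of_subset h'
    _ ≤ _ := Finset.sum_le_sum_of_subset h

lemma ec_le_mul (A B : Finset V) : ec G A B ≤ A.card * B.card := by
  unfold ec
  calc _ ≤ ∑ a ∈ A, ∑ b ∈ B, 1 :=
        Finset.sum_le_sum fun a _ => Finset.sum_le_sum fun b _ => by split_ifs <;> simp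
    _ = _ := by simp

lemma ec_singleton (a : V) (B : Finset V) : ec G {a} B = (G.neighborFinset a ∩ B).card := by
  unfold ec
  rw [Finset.sum_singleton, ← Finset.sum_filter, Finset.card_eq_sum_ones]
  refine Finset.sum_congr ?_ fun _ _ => rfl
  ext x; simp [and_comm]

lemma ec_eq_sum (A B : Finset V) : ec G A B = ∑ a ∈ A, ec G {a} B := by
  simp [ec]

lemma ec_self_singleton (a : V) : ec G {a} {a} = 0 := by simp [ec]

variable {G}

lemma ec_univ (hreg : G.IsRegularOfDegree 5) (A : Finset V) : ec G A Finset.univ = 5 * A.card := by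
  rw [ec_eq_sum, Finset.sum_congr rfl (g := fun _ => 5), Finset.sum_const, smul_eq_mul, mul_comm]
  intro a _
  rw [ec_singleton, Finset.inter_univ]
  exact hreg a

/-- if the sets `A`, `B` partition `C`... -/
lemma ec_split (A C B : Finset V) (h : A ⊆ B) : ec G C B = ec G C A + ec G C (B \ A) := by
  rw [← ec_union_right G C Finset.disjoint_sdiff, Finset.union_sdiff_of_subset h]

lemma ec_compl (hreg : G.IsRegularOfDegree 5) (A B : Finset V) :
    ec G A B + ec G A Bᶜ = 5 * A.card := by
  rw [← ec_univ hreg A, ← ec_union_right G A disjoint_compl_right, Finset.union_compl]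

lemma bd_eq (hreg : G.IsRegularOfDegree 5) (A : Finset V) :
    ec G A A + bd G A = 5 * A.card := ec_compl hreg A A

lemma bd_compl (A : Finset V) : bd G Aᶜ = bd G A := by
  unfold bd; rw [compl_compl, ec_comm]

lemma ec_self_even (A : Finset V) : Even (ec G A A) := by
  induction A using Finset.induction_on with
  | empty => simp [ec]
  | insert a A ha ih =>
    have hd : Disjoint {a} A := by simpa using ha
    rw [Finset.insert_eq, ec_union_left G _ hd, ec_union_right G _ hd, ec_union_right G _ hd,
      ec_self_singleton, ec_comm G A {a}]
    obtain ⟨k, hk⟩ := ih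
    exact ⟨ec G {a} A + k, by omega⟩

lemma ec_self_le (A : Finset V) : ec G A A ≤ A.card * (A.card - 1) := by
  rw [ec_eq_sum, ← smul_eq_mul, ← Finset.sum_const]
  refine Finset.sum_le_sum fun a ha => ?_
  rw [ec_singleton, ← Finset.card_erase_of_mem ha]
  refine Finset.card_le_card fun x hx => ?_
  simp at hx ⊢
  exact ⟨hx.1.ne', hx.2⟩

lemma ec_map (φ : G ≃g G) (A B : Finset V) :
    ec G (A.map φ.toEquiv.toEmbedding) (B.map φ.toEquiv.toEmbedding) = ec G A B := by
  unfold ec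
  rw [Finset.sum_map]
  refine Finset.sum_congr rfl fun a _ => ?_
  rw [Finset.sum_map]
  refine Finset.sum_congr rfl fun b _ => ?_
  have h : G.Adj (φ a) (φ b) ↔ G.Adj a b := φ.map_adj_iff
  exact if_congr h rfl rfl

lemma ec_nbr_self (htri : G.CliqueFree 3) (p : V) (A B : Finset V)
    (hA : A ⊆ G.neighborFinset p) (hB : B ⊆ G.neighborFinset p) : ec G A B = 0 := by
  rw [ec_eq_zero]
  intro a ha b hb hab
  have h1 := hA ha
  have h2 := hB hb
  rw [mem_neighborFinset] at h1 h2
  exact htri {p, a, b} (by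
    rw [is3Clique_triple_iff]; exact ⟨h1, h2, hab⟩)

lemma mantel (htri : G.CliqueFree 3) (A : Finset V) (hA : A.Nonempty) :
    ∃ p ∈ A, ec G A A ≤ A.card * ec G {p} A ∧
      ec G {p} A ≤ A.card ∧ ec G A A ≤ 2 * (ec G {p} A * (A.card - ec G {p} A)) := by
  obtain ⟨p, hp, hmax⟩ := Finset.exists_max_image A (fun a => ec G {a} A) hA
  refine ⟨p, hp, ?_, ?_, ?_⟩
  · rw [ec_eq_sum, ← smul_eq_mul, ← Finset.sum_const]
    exact Finset.sum_le_sum hmax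
  · simpa using ec_le_mul G {p} A
  set N := G.neighborFinset p ∩ A with hN
  have hcard : N.card = ec G {p} A := (ec_singleton G p A).symm
  have hNA : N ⊆ A := Finset.inter_subset_right
  have h0 : ec G N N = 0 := ec_nbr_self htri p N N Finset.inter_subset_left Finset.inter_subset_left
  have h1 : ec G A A = ec G (A \ N) A + ec G N A := by
    rw [← ec_union_left G A Finset.sdiff_disjoint, Finset.sdiff_union_of_subset hNA]
  have h2 : ec G N A = ec G N N + ec G N (A \ N) := ec_split N N A hNA
  have h3 : ec G N (A \ N) ≤ ec G (A \ N) A := by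
    rw [ec_comm]; exact ec_mono G (Finset.Subset.refl _) hNA
  have h4 : ec G (A \ N) A ≤ ec G {p} A * (A.card - ec G {p} A) := by
    rw [ec_eq_sum, ← hcard, ← Finset.card_sdiff_of_subset hNA, mul_comm, ← smul_eq_mul,
      ← Finset.sum_const]
    refine Finset.sum_le_sum fun a ha => ?_
    rw [hcard]
    exact hmax a (Finset.sdiff_subset ha)
  omega

lemma small_bd (hreg : G.IsRegularOfDegree 5) (htri : G.CliqueFree 3) (A : Finset V)
    (h1 : 1 ≤ A.card) (h7 : A.card ≤ 7) :
    5 ≤ bd G A ∧ (3 ≤ A.card → 11 ≤ bd G A) ∧ (A.card = 5 → 13 ≤ bd G A) ∧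
    (A.card = 2 → 8 ≤ bd G A) := by
  obtain ⟨p, _, -, hle, hm⟩ := mantel htri A (Finset.card_pos.mp h1)
  have hb := bd_eq hreg A
  generalize ec G {p} A = d at *
  generalize A.card = s at *
  have hd : d ≤ 7 := by omega
  interval_cases s <;> interval_cases d <;> omega

lemma bd_pos (hconn : G.Connected) (A : Finset V) (h1 : A.Nonempty) (h2 : Aᶜ.Nonempty) :
    1 ≤ bd G A := by
  by_contra hlt
  have h0 : ec G A Aᶜ = 0 := by unfold bd at hlt; omega
  rw [ec_eq_zero] at h0
  obtain ⟨a, ha⟩ := h1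
  obtain ⟨b, hb⟩ := h2
  obtain ⟨w⟩ := hconn.preconnected a b
  have : ∀ {x y : V}, G.Walk x y → x ∈ A → y ∈ A := by
    intro x y w
    induction w with
    | nil => exact id
    | cons h _ ih =>
      intro hx
      apply ih
      by_contra hy
      exact h0 _ hx _ (by simpa using hy) h
  exact (Finset.mem_compl.mp hb) (this w ha)

end Basic

section Lam

variable {V : Type*} [Fintype V] [DecidableEq V] {G : SimpleGraph V} [DecidableRel G.Adj]

lemma edgeBoundary_ncard (A : Finset V) : (edgeBoundary G (A : Set V)).ncard = bd G A := by
  have h : edgeBoundary G (A : Set V) =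
      (((A ×ˢ Aᶜ).filter fun p : V × V => G.Adj p.1 p.2).image fun p => s(p.1, p.2) : Finset (Sym2 V)) := by
    ext e
    simp only [edgeBoundary, Set.mem_ofPred_eq, Finset.coe_image, Set.mem_image, Finset.mem_coe,
      Finset.mem_filter, Finset.mem_product, Finset.mem_compl, Prod.exists, Set.mem_compl_iff]
    constructor
    · rintro ⟨he, x, hx, y, hy, rfl⟩
      exact ⟨x, y, ⟨⟨hx, hy⟩, by simpa using he⟩, rfl⟩
    · rintro ⟨x, y, ⟨⟨hx, hy⟩, h⟩, rfl⟩
      exact ⟨by simpa using h, x, hx, y, hy, rfl⟩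
  rw [h, Set.ncard_coe_finset, Finset.card_image_of_injOn, Finset.card_filter, Finset.sum_product]
  · rfl
  · rintro ⟨a, b⟩ h1 ⟨c, d⟩ h2 h3
    simp only [Finset.coe_filter, Finset.mem_product, Finset.mem_compl, Set.mem_ofPred_eq] at h1 h2
    simp only [Sym2.eq_iff] at h3
    rcases h3 with ⟨rfl, rfl⟩ | ⟨rfl, rfl⟩
    · rfl
    · exact absurd h1.1.1 h2.1.2

end Lam

section Lam2

variable {V : Type*} [Fintype V] [DecidableEq V] {G : SimpleGraph V} [DecidableRel G.Adj]

lemma lam_aux (hreg : G.IsRegularOfDegree 5) (htri : G.CliqueFree 3)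
    (k : ℕ) (hk6 : 6 ≤ k) (hk8 : k ≤ 8) (B K : Finset V) (hB : k ≤ B.card) (hBc : k ≤ Bᶜ.card)
    (h14 : bd G B ≤ 14)
    (hmin : ∀ A : Finset V, k ≤ A.card → k ≤ Aᶜ.card → bd G B ≤ bd G A)
    (hK : K.Nonempty) (hKB : K ⊆ B) (h0 : ∀ x ∈ K, ∀ y ∈ B \ K, ¬ G.Adj x y) : k ≤ K.card := by
  by_contra hlt
  push Not at hlt
  have hd : Disjoint K (B \ K) := Finset.disjoint_sdiff
  have hu : K ∪ (B \ K) = B := Finset.union_sdiff_of_subset hKB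
  have hz : ec G K (B \ K) = 0 := (ec_eq_zero G).2 h0
  have e1 : ec G B B = ec G K K + ec G (B \ K) (B \ K) := by
    conv_lhs => rw [← hu]
    rw [ec_union_left G _ hd, ec_union_right G _ hd, ec_union_right G _ hd, ec_comm G (B \ K) K, hz]
    omega
  have c1 : K.card + (B \ K).card = B.card := by
    rw [← Finset.card_union_of_disjoint hd, hu]
  have b1 := bd_eq hreg B
  have b2 := bd_eq hreg K
  have b3 := bd_eq hreg (B \ K)
  have hc : Bᶜ.card ≤ (B \ K)ᶜ.card :=
    Finset.card_le_card (Finset.compl_subset_compl.mpr Finset.sdiff_subset)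
  have hKpos : 1 ≤ K.card := Finset.card_pos.mpr hK
  obtain ⟨s1, s2, -, -⟩ := small_bd hreg htri K hKpos (by omega)
  by_cases hbig : k ≤ (B \ K).card
  · have := hmin (B \ K) hbig (by omega)
    omega
  · obtain ⟨t1, t2, -, -⟩ := small_bd hreg htri (B \ K) (by omega) (by omega)
    by_cases h3 : 3 ≤ K.card
    · have := s2 h3; omega
    · have := t2 (by omega); omega

lemma lam (hreg : G.IsRegularOfDegree 5) (htri : G.CliqueFree 3)
    (k : ℕ) (hk6 : 6 ≤ k) (hk8 : k ≤ 8) (A : Finset V) (hA : k ≤ A.card) (hAc : k ≤ Aᶜ.card)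
    (h14 : bd G A ≤ 14) : lambdaS G k ≤ bd G A := by
  classical
  obtain ⟨B, hB, hmin⟩ := Finset.exists_min_image
    (Finset.univ.filter fun B : Finset V => k ≤ B.card ∧ k ≤ Bᶜ.card) (bd G)
    ⟨A, by simp only [Finset.mem_filter, Finset.mem_univ, true_and]; exact ⟨hA, hAc⟩⟩
  simp only [Finset.mem_filter, Finset.mem_univ, true_and, and_imp] at hB hmin
  have hBA := hmin A hA hAc
  refine le_trans ?_ hBA
  have key : ∀ x y, (G.deleteEdges (edgeBoundary G (B : Set V))).Adj x y → (x ∈ B ↔ y ∈ B) := by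
    intro x y h
    rw [deleteEdges_adj] at h
    by_contra hne
    apply h.2
    by_cases hx : x ∈ B
    · exact ⟨h.1, x, hx, y, fun hy => hne ⟨fun _ => hy, fun _ => hx⟩, rfl⟩
    · have hy : y ∈ B := by tauto
      exact ⟨h.1, y, hy, x, hx, Sym2.eq_swap⟩
  have keyw : ∀ {x y}, (G.deleteEdges (edgeBoundary G (B : Set V))).Walk x y → (x ∈ B ↔ y ∈ B) := by
    intro x y w
    induction w with
    | nil => exact Iff.rfl
    | cons h _ ih => exact (key _ _ h).trans ih
  have hres : IsRestrictedEdgeCut G k (edgeBoundary G (B : Set V)) := by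
    refine ⟨fun e he => he.1, ?_, ?_⟩
    · intro hc
      obtain ⟨a, ha⟩ := Finset.card_pos.mp (show 0 < B.card by omega)
      obtain ⟨b, hb⟩ := Finset.card_pos.mp (show 0 < Bᶜ.card by omega)
      obtain ⟨w⟩ := hc.preconnected a b
      exact (Finset.mem_compl.mp hb) ((keyw w).1 ha)
    · intro c
      obtain ⟨v, rfl⟩ := c.exists_rep
      set c := (G.deleteEdges (edgeBoundary G (B : Set V))).connectedComponentMk v with hc
      obtain ⟨K, hKc⟩ : ∃ K : Finset V, (K : Set V) = c.supp := ⟨(Set.toFinite c.supp).toFinset, by simp⟩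
      change k ≤ c.supp.ncard
      rw [← hKc, Set.ncard_coe_finset]
      have hmem : ∀ x, x ∈ K ↔
          (G.deleteEdges (edgeBoundary G (B : Set V))).Reachable x v := by
        intro x
        rw [← Finset.mem_coe, hKc, ConnectedComponent.mem_supp_iff, hc, ConnectedComponent.eq]
      have hv : v ∈ K := (hmem v).2 (Reachable.refl _)
      have hside : ∀ x ∈ K, (x ∈ B ↔ v ∈ B) := by
        intro x hx
        obtain ⟨w⟩ := (hmem x).1 hx
        exact keyw w
      have hstep : ∀ x ∈ K, ∀ y, G.Adj x y → (x ∈ B ↔ y ∈ B) → y ∈ K := by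
        intro x hx y hxy hiff
        rw [hmem]
        refine Reachable.trans (Adj.reachable ?_) ((hmem x).1 hx)
        rw [deleteEdges_adj]
        refine ⟨hxy.symm, ?_⟩
        rintro ⟨-, a, ha, b, hb, hab⟩
        rw [Sym2.eq_iff] at hab
        rcases hab with ⟨rfl, rfl⟩ | ⟨rfl, rfl⟩
        · exact hb (hiff.2 ha)
        · exact hb (hiff.1 ha)
      by_cases hvB : v ∈ B
      · refine lam_aux hreg htri k hk6 hk8 B _ hB.1 hB.2 (by omega) hmin ⟨v, hv⟩
          (fun x hx => (hside x hx).2 hvB) ?_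
        intro x hx y hy hxy
        rw [Finset.mem_sdiff] at hy
        have hxB := (hside x hx).2 hvB
        exact hy.2 (hstep x hx y hxy ⟨fun _ => hy.1, fun _ => hxB⟩)
      · refine lam_aux hreg htri k hk6 hk8 Bᶜ _ hB.2 (by rw [compl_compl]; exact hB.1)
          (by rw [bd_compl]; omega) (by rw [bd_compl]; exact hmin) ⟨v, hv⟩
          (fun x hx => Finset.mem_compl.2 fun h => hvB ((hside x hx).1 h)) ?_
        intro x hx y hy hxy
        rw [Finset.mem_sdiff, Finset.mem_compl] at hy
        have hxB : x ∉ B := fun h => hvB ((hside x hx).1 h)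
        exact hy.2 (hstep x hx y hxy ⟨fun h => absurd h hxB, fun h => absurd h hy.1⟩)
  rw [← edgeBoundary_ncard]
  exact Nat.sInf_le ⟨_, hres, rfl⟩

/-- Bundled working hypotheses. -/
structure Hyp (G : SimpleGraph V) [DecidableRel G.Adj] : Prop where
  conn : G.Connected
  vt : VertexTransitive G
  nb : ¬ G.Colorable 2
  tri : G.CliqueFree 3
  reg : G.IsRegularOfDegree 5
  n16 : 16 ≤ Fintype.card V
  b6 : ∀ A : Finset V, 6 ≤ A.card → 6 ≤ Aᶜ.card → 14 ≤ bd G A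
  b8 : ∀ A : Finset V, 8 ≤ A.card → 8 ≤ Aᶜ.card → 15 ≤ bd G A

lemma card_compl_add (A : Finset V) : A.card + Aᶜ.card = Fintype.card V :=
  Finset.card_add_card_compl A

lemma b3 (H : Hyp G) (A : Finset V) (h : 3 ≤ A.card) (hc : 3 ≤ Aᶜ.card) : 11 ≤ bd G A := by
  have h1 := card_compl_add A
  have h2 := H.n16
  by_cases h6 : A.card ≤ 5
  · exact (small_bd H.reg H.tri A (by omega) (by omega)).2.1 h
  · by_cases h6' : Aᶜ.card ≤ 5
    · rw [← bd_compl]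
      exact (small_bd H.reg H.tri Aᶜ (by omega) (by omega)).2.1 hc
    · have := H.b6 A (by omega) (by omega)
      omega

lemma b1 (H : Hyp G) (A : Finset V) (h : 1 ≤ A.card) (hc : 3 ≤ Aᶜ.card) : 5 ≤ bd G A := by
  by_cases h3 : 3 ≤ A.card
  · have := b3 H A h3 hc; omega
  · exact (small_bd H.reg H.tri A (by omega) (by omega)).1

lemma hyp_of (hconn : G.Connected) (hvt : VertexTransitive G) (hnb : ¬ G.Colorable 2)
    (htri : G.CliqueFree 3) (hreg : G.IsRegularOfDegree 5)
    (h6 : 14 ≤ lambdaS G 6) (h8 : lambdaS G 8 = 15)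
    (S : Set V) (hS : IsLambdaAtom G 8 S) : Hyp G := by
  refine ⟨hconn, hvt, hnb, htri, hreg, ?_, ?_, ?_⟩
  · obtain ⟨⟨⟨-, hnc, hcomp⟩, -⟩, -⟩ := hS
    have := hconn.nonempty
    have : ¬ (G.deleteEdges (edgeBoundary G S)).Preconnected := fun h => hnc ⟨h⟩
    unfold SimpleGraph.Preconnected at this
    push Not at this
    obtain ⟨u, v, huv⟩ := this
    have hu := hcomp ((G.deleteEdges (edgeBoundary G S)).connectedComponentMk u)
    have hv := hcomp ((G.deleteEdges (edgeBoundary G S)).connectedComponentMk v)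
    have hd : Disjoint ((G.deleteEdges (edgeBoundary G S)).connectedComponentMk u).supp
        ((G.deleteEdges (edgeBoundary G S)).connectedComponentMk v).supp := by
      rw [Set.disjoint_left]
      intro x hx hx'
      rw [ConnectedComponent.mem_supp_iff] at hx hx'
      exact huv (ConnectedComponent.eq.1 (hx.symm.trans hx'))
    have h1 := Set.ncard_union_eq hd (Set.toFinite _) (Set.toFinite _)
    have h2 := Set.ncard_le_card (((G.deleteEdges (edgeBoundary G S)).connectedComponentMk u).supp ∪
        ((G.deleteEdges (edgeBoundary G S)).connectedComponentMk v).supp)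
    rw [Nat.card_eq_fintype_card] at h2
    omega
  · intro A hA hAc
    by_contra hlt
    have := lam hreg htri 6 (by norm_num) (by norm_num) A hA hAc (by omega)
    omega
  · intro A hA hAc
    by_contra hlt
    have := lam hreg htri 8 (by norm_num) (by norm_num) A hA hAc (by omega)
    omega

end Lam2

section NB

variable {V : Type*} [Fintype V] [DecidableEq V] {G : SimpleGraph V} [DecidableRel G.Adj]

/-- The graph of monochromatic edges with respect to the 2-colouring `(P, Pᶜ)`. -/
def Mg (G : SimpleGraph V) (P : Finset V) : SimpleGraph V where
  Adj a b := G.Adj a b ∧ (a ∈ P ↔ b ∈ P)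
  symm := ⟨fun _ _ h => ⟨h.1.symm, h.2.symm⟩⟩
  loopless := ⟨fun a h => G.loopless.irrefl a h.1⟩

instance (P : Finset V) : DecidableRel (Mg G P).Adj :=
  fun a b => inferInstanceAs (Decidable (G.Adj a b ∧ (a ∈ P ↔ b ∈ P)))

lemma Mg_adj (P : Finset V) (a b : V) : (Mg G P).Adj a b ↔ G.Adj a b ∧ (a ∈ P ↔ b ∈ P) := Iff.rfl

lemma ec_congr' {G₁ G₂ : SimpleGraph V} [DecidableRel G₁.Adj] [DecidableRel G₂.Adj]
    (A B : Finset V) (h : ∀ a ∈ A, ∀ b ∈ B, (G₁.Adj a b ↔ G₂.Adj a b)) :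
    ec G₁ A B = ec G₂ A B := by
  unfold ec
  exact Finset.sum_congr rfl fun a ha => Finset.sum_congr rfl fun b hb =>
    if_congr (h a ha b hb) rfl rfl

/-- Twice the number of monochromatic edges. -/
def M2 (G : SimpleGraph V) [DecidableRel G.Adj] (P : Finset V) : ℕ :=
  ec (Mg G P) Finset.univ Finset.univ

lemma ec_univ_split (K : SimpleGraph V) [DecidableRel K.Adj] (T : Finset V) :
    ec K Finset.univ Finset.univ = ec K T T + 2 * ec K T Tᶜ + ec K Tᶜ Tᶜ := by
  rw [← Finset.union_compl T, ec_union_left K _ disjoint_compl_right,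
    ec_union_right K _ disjoint_compl_right, ec_union_right K _ disjoint_compl_right,
    ec_comm K Tᶜ T]
  ring

lemma mem_iff_of_notMem_symmDiff {P Q : Finset V} {x : V} (h : x ∉ symmDiff P Q) :
    (x ∈ P ↔ x ∈ Q) := by
  rw [Finset.mem_symmDiff] at h; tauto

lemma M2_symmDiff (P Q : Finset V) :
    M2 G Q + 4 * ec (Mg G P) (symmDiff P Q) (symmDiff P Q)ᶜ = M2 G P + 2 * bd G (symmDiff P Q) := by
  set T := symmDiff P Q with hT
  have h1 : ec (Mg G P) T T = ec (Mg G Q) T T := by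
    refine ec_congr' _ _ fun a ha b hb => ?_
    rw [hT, Finset.mem_symmDiff] at ha hb
    rw [Mg_adj, Mg_adj]; tauto
  have h2 : ec (Mg G P) Tᶜ Tᶜ = ec (Mg G Q) Tᶜ Tᶜ := by
    refine ec_congr' _ _ fun a ha b hb => ?_
    rw [hT, Finset.mem_compl, Finset.mem_symmDiff] at ha hb
    rw [Mg_adj, Mg_adj]; tauto
  have h3 : ec (Mg G P) T Tᶜ + ec (Mg G Q) T Tᶜ = bd G T := by
    unfold bd ec
    rw [← Finset.sum_add_distrib]
    refine Finset.sum_congr rfl fun a ha => ?_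
    rw [← Finset.sum_add_distrib]
    refine Finset.sum_congr rfl fun b hb => ?_
    rw [hT, Finset.mem_symmDiff] at ha
    rw [hT, Finset.mem_compl, Finset.mem_symmDiff] at hb
    simp only [Mg_adj]
    by_cases hab : G.Adj a b
    · by_cases h4 : a ∈ P <;> by_cases h5 : b ∈ P <;> by_cases h6 : a ∈ Q <;> by_cases h7 : b ∈ Q <;>
        simp_all
    · simp [hab]
  have h4 := ec_univ_split (Mg G P) T
  have h5 := ec_univ_split (Mg G Q) T
  unfold M2
  omega

lemma Mg_compl (P : Finset V) : Mg G Pᶜ = Mg G P := by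
  ext a b
  rw [Mg_adj, Mg_adj, Finset.mem_compl, Finset.mem_compl]; tauto

lemma M2_pos (H : Hyp G) (P : Finset V) : 1 ≤ M2 G P := by
  by_contra hlt
  have h0 : ec (Mg G P) Finset.univ Finset.univ = 0 := by unfold M2 at hlt; omega
  rw [ec_eq_zero] at h0
  apply H.nb
  refine ⟨Coloring.mk (fun v => if v ∈ P then (0 : Fin 2) else 1) ?_⟩
  intro v w hvw
  have := h0 v (Finset.mem_univ _) w (Finset.mem_univ _)
  rw [Mg_adj] at this
  by_cases h1 : v ∈ P <;> by_cases h2 : w ∈ P <;> simp_all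

lemma mem_map_iso (φ : G ≃g G) (A : Finset V) (x : V) :
    φ x ∈ A.map φ.toEquiv.toEmbedding ↔ x ∈ A := by
  rw [Finset.mem_map]
  constructor
  · rintro ⟨y, hy, hxy⟩
    have : y = x := φ.injective hxy
    rwa [← this]
  · exact fun h => ⟨x, h, rfl⟩

lemma Mg_map (φ : G ≃g G) (P A B : Finset V) :
    ec (Mg G (P.map φ.toEquiv.toEmbedding)) (A.map φ.toEquiv.toEmbedding)
      (B.map φ.toEquiv.toEmbedding) = ec (Mg G P) A B := by
  unfold ec
  rw [Finset.sum_map]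
  refine Finset.sum_congr rfl fun a _ => ?_
  rw [Finset.sum_map]
  refine Finset.sum_congr rfl fun b _ => ?_
  have h : G.Adj (φ a) (φ b) ↔ G.Adj a b := φ.map_adj_iff
  refine if_congr ?_ rfl rfl
  rw [Mg_adj, Mg_adj]
  exact and_congr h (iff_congr (mem_map_iso φ P a) (mem_map_iso φ P b))

lemma nb_lemma (H : Hyp G) (P₀ : Finset V) (hM : M2 G P₀ ≤ 10) : False := by
  obtain ⟨P, -, hmin⟩ := Finset.exists_min_image (Finset.univ : Finset (Finset V)) (M2 G)
    ⟨P₀, Finset.mem_univ _⟩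
  have hP10 : M2 G P ≤ 10 := (hmin P₀ (Finset.mem_univ _)).trans hM
  clear hM P₀
  have hpos := M2_pos H P
  set md : V → ℕ := fun z => ec (Mg G P) {z} Finset.univ with hmd
  have hsum : ∑ z, md z = M2 G P := (ec_eq_sum (Mg G P) Finset.univ Finset.univ).symm
  have hmd2 : ∀ z, md z ≤ 2 := by
    intro z
    have h1 := M2_symmDiff (G := G) P (symmDiff P {z})
    rw [symmDiff_symmDiff_cancel_left] at h1
    have h2 := hmin (symmDiff P {z}) (Finset.mem_univ _)
    have h3 := bd_eq H.reg {z}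
    rw [ec_self_singleton, Finset.card_singleton] at h3
    have h4 := ec_split (G := Mg G P) {z} {z} Finset.univ (Finset.subset_univ _)
    rw [ec_self_singleton, ← Finset.compl_eq_univ_sdiff] at h4
    simp only [hmd]
    omega
  have hne : (Finset.univ : Finset V).Nonempty := by
    rw [← Finset.card_pos, Finset.card_univ]; have := H.n16; omega
  obtain ⟨z0, -, hz0⟩ := Finset.exists_max_image Finset.univ md hne
  have hz1 : 1 ≤ md z0 := by
    by_contra hlt
    have : ∑ z, md z = 0 := Finset.sum_eq_zero fun z hz => by have := hz0 z hz; omega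
    omega
  obtain ⟨w, hw⟩ : ∃ w, md w = 0 := by
    by_contra hcon
    push Not at hcon
    have : ∑ _z : V, 1 ≤ ∑ z, md z :=
      Finset.sum_le_sum fun z _ => Nat.one_le_iff_ne_zero.mpr (hcon z)
    rw [Finset.sum_const, Finset.card_univ, smul_eq_mul] at this
    have := H.n16
    omega
  obtain ⟨φ, hφ⟩ := H.vt z0 w
  obtain ⟨Q, hQ1, hQ2, hQ3⟩ : ∃ Q : Finset V, M2 G Q = M2 G P ∧
      ec (Mg G Q) {w} Finset.univ = md z0 ∧ (symmDiff P Q).card ≤ 2 := by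
    set Q := P.map φ.toEquiv.toEmbedding with hQ
    have hu : (Finset.univ : Finset V).map φ.toEquiv.toEmbedding = Finset.univ := by
      rw [Finset.map_univ_equiv]
    have h1 : M2 G Q = M2 G P := by
      have := Mg_map φ P Finset.univ Finset.univ
      rw [hu] at this
      exact this
    have h2 : ec (Mg G Q) {w} Finset.univ = md z0 := by
      have := Mg_map φ P {z0} Finset.univ
      rw [hu, Finset.map_singleton] at this
      rw [← hφ]
      exact this
    have h3 := M2_symmDiff (G := G) P Q
    have h4 := ec_univ_split (Mg G P) (symmDiff P Q)
    have h5 : bd G (symmDiff P Q) ≤ 10 := by unfold M2 at *; omega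
    by_cases h6 : (symmDiff P Q).card ≤ 2
    · exact ⟨Q, h1, h2, h6⟩
    · refine ⟨Qᶜ, ?_, ?_, ?_⟩
      · rw [← h1]; unfold M2
        exact ec_congr' _ _ fun a _ b _ => by rw [Mg_compl]
      · rw [← h2]
        exact ec_congr' _ _ fun a _ b _ => by rw [Mg_compl]
      · have h7 : symmDiff P Qᶜ = (symmDiff P Q)ᶜ := by
          ext x
          simp only [Finset.mem_symmDiff, Finset.mem_compl]; tauto
        rw [h7]
        by_contra h8
        have := b3 H (symmDiff P Q) (by omega) (by omega)
        omega
  have h3 := M2_symmDiff (G := G) P Q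
  set T := symmDiff P Q with hT
  have hb := bd_eq H.reg T
  have hTc : T.card = 0 ∨ T.card = 1 ∨ T.card = 2 := by omega
  rcases hTc with h0 | h1 | h2
  · have : P = Q := by
      rw [Finset.card_eq_zero] at h0
      exact symmDiff_eq_bot.1 (hT ▸ h0)
    subst this
    simp only [hmd] at hw hQ2 hz1
    omega
  · obtain ⟨z, hz⟩ := Finset.card_eq_one.1 h1
    have : ec G T T = 0 := by rw [hz]; exact ec_self_singleton G z
    omega
  · obtain ⟨z, z', hzz, hz⟩ := Finset.card_eq_two.1 h2
    have hd : Disjoint ({z} : Finset V) {z'} := by simpa using hzz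
    have hzu : T = {z} ∪ {z'} := by rw [hz]; rfl
    have h4 : ec (Mg G P) T Tᶜ ≤ md z + md z' := by
      have : ec (Mg G P) T Tᶜ ≤ ec (Mg G P) T Finset.univ :=
        ec_mono _ (Finset.Subset.refl _) (Finset.subset_univ _)
      refine this.trans ?_
      rw [hzu, ec_union_left _ _ hd]
    have h5 := hmd2 z
    have h6 := hmd2 z'
    have h7 := ec_self_le (G := G) T
    rw [h2] at h7
    have h8 : ec G T T = 2 * ec G {z} {z'} := by
      rw [hzu, ec_union_left _ _ hd, ec_union_right _ _ hd, ec_union_right _ _ hd,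
        ec_self_singleton, ec_self_singleton, ec_comm G {z'} {z}]
      omega
    have hadj : G.Adj z z' := by
      by_contra hna
      have : ec G {z} {z'} = 0 := by simp [ec, hna]
      omega
    have hwT : w ∉ T := by
      intro hw'
      rw [hz] at hw'
      simp only [Finset.mem_insert, Finset.mem_singleton] at hw'
      rcases hw' with rfl | rfl <;> omega
    have hz0z := hz0 z (Finset.mem_univ _)
    have hsub : (Mg G Q).neighborFinset w ∩ Finset.univ ⊆ T := by
      intro b hb
      by_contra hbT
      simp only [Finset.inter_univ, mem_neighborFinset] at hb
      have hPb : (Mg G P).Adj w b := by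
        have e1 := mem_iff_of_notMem_symmDiff hwT
        have e2 := mem_iff_of_notMem_symmDiff hbT
        rw [Mg_adj] at hb ⊢
        tauto
      have hw0 : ec (Mg G P) {w} Finset.univ = 0 := hw
      rw [ec_eq_zero] at hw0
      exact hw0 w (by simp) b (by simp) hPb
    rw [ec_singleton] at hQ2
    have heq := Finset.eq_of_subset_of_card_le hsub (by omega)
    have hz_mem : z ∈ (Mg G Q).neighborFinset w ∩ Finset.univ := by rw [heq, hz]; simp
    have hz'_mem : z' ∈ (Mg G Q).neighborFinset w ∩ Finset.univ := by rw [heq, hz]; simp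
    simp only [Finset.inter_univ, mem_neighborFinset] at hz_mem hz'_mem
    exact H.tri {w, z, z'} (by rw [is3Clique_triple_iff]; exact ⟨hz_mem.1, hz'_mem.1, hadj⟩)

end NB

section CPs

variable {V : Type*} [Fintype V] [DecidableEq V] {G : SimpleGraph V} [DecidableRel G.Adj]

/-- All neighbours of `I` lie in `X`, which is disjoint from `I`. -/
structure NC (G : SimpleGraph V) (X I : Finset V) : Prop where
  disj : Disjoint X I
  nbr : ∀ u ∈ I, ∀ v, G.Adj u v → v ∈ X

lemma NC.ecII {X I : Finset V} (h : NC G X I) : ec G I I = 0 := by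
  rw [ec_eq_zero]
  intro a ha b hb hab
  exact Finset.disjoint_left.1 h.disj (h.nbr a ha b hab) hb

lemma NC.ecIX (hreg : G.IsRegularOfDegree 5) {X I : Finset V} (h : NC G X I) :
    ec G I X = 5 * I.card := by
  have h1 := ec_compl hreg I X
  have h2 : ec G I Xᶜ = 0 := by
    rw [ec_eq_zero]
    intro a ha b hb hab
    exact (Finset.mem_compl.1 hb) (h.nbr a ha b hab)
  omega

lemma NC.bd (hreg : G.IsRegularOfDegree 5) {X I : Finset V} (h : NC G X I) :
    bd G (X ∪ I) + 5 * I.card + ec G X X = 5 * X.card := by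
  have h1 := bd_eq hreg (X ∪ I)
  rw [ec_union_left _ _ h.disj, ec_union_right _ _ h.disj, ec_union_right _ _ h.disj, h.ecII,
    ec_comm G X I, h.ecIX hreg, Finset.card_union_of_disjoint h.disj] at h1
  omega

lemma M2_eq (P : Finset V) : M2 G P = ec G P P + ec G Pᶜ Pᶜ := by
  unfold M2
  rw [ec_univ_split (Mg G P) P]
  have h1 : ec (Mg G P) P P = ec G P P :=
    ec_congr' _ _ fun a ha b hb => by rw [Mg_adj]; tauto
  have h2 : ec (Mg G P) Pᶜ Pᶜ = ec G Pᶜ Pᶜ :=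
    ec_congr' _ _ fun a ha b hb => by
      rw [Finset.mem_compl] at ha hb; rw [Mg_adj]; tauto
  have h3 : ec (Mg G P) P Pᶜ = 0 := by
    rw [ec_eq_zero]
    intro a ha b hb hab
    rw [Finset.mem_compl] at hb; rw [Mg_adj] at hab; tauto
  omega

lemma NC.M2 {X I : Finset V} (h : NC G X I) :
    M2 G X = ec G X X + ec G (X ∪ I)ᶜ (X ∪ I)ᶜ := by
  rw [M2_eq]
  congr 1
  have hd : Disjoint I (X ∪ I)ᶜ :=
    Finset.disjoint_left.2 fun x hx hx' => (Finset.mem_compl.1 hx') (Finset.mem_union_right _ hx)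
  have hX : Xᶜ = I ∪ (X ∪ I)ᶜ := by
    ext x
    have : x ∈ X → x ∉ I := fun hx => Finset.disjoint_left.1 h.disj hx
    simp only [Finset.mem_compl, Finset.mem_union]
    tauto
  have h0 : ec G I (X ∪ I)ᶜ = 0 := by
    rw [ec_eq_zero]
    intro a ha b hb hab
    exact (Finset.mem_compl.1 hb) (Finset.mem_union_left _ (h.nbr a ha b hab))
  rw [hX, ec_union_left _ _ hd, ec_union_right _ _ hd, ec_union_right _ _ hd, h.ecII,
    ec_comm G _ I, h0]
  omega

lemma NC.card5 (hreg : G.IsRegularOfDegree 5) {X I : Finset V} (h : NC G X I) (hI : I.Nonempty) :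
    5 ≤ X.card := by
  obtain ⟨u, hu⟩ := hI
  rw [← hreg u, ← card_neighborFinset_eq_degree]
  exact Finset.card_le_card fun v hv => h.nbr u hu v (by simpa using hv)

/-- closed pair -/
structure CP (G : SimpleGraph V) [DecidableRel G.Adj] (X I : Finset V) : Prop extends NC G X I where
  ind : ec G X X = 0

lemma CP.mono_ind {X Y : Finset V} (h : ec G X X = 0) (hY : Y ⊆ X) : ec G Y Y = 0 := by
  have := ec_mono G hY hY
  omega

lemma CP.diff (H : Hyp G) {X I : Finset V} (h : CP G X I) (hI : I.Nonempty)
    (hc : 3 ≤ (X ∪ I)ᶜ.card) : I.card + 3 ≤ X.card := by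
  have h1 := h.toNC.bd H.reg
  have h2 := h.toNC.card5 H.reg hI
  have h3 : X.card ≤ (X ∪ I).card := Finset.card_le_card Finset.subset_union_left
  have h4 := b3 H (X ∪ I) (by omega) hc
  omega

lemma CP.compl3 (H : Hyp G) {X I : Finset V} (h : CP G X I) (hd : X.card = I.card + 3) :
    3 ≤ (X ∪ I)ᶜ.card := by
  have h1 := h.toNC.bd H.reg
  have h2 := bd_eq H.reg (X ∪ I)ᶜ
  rw [bd_compl] at h2
  have := h.ind
  omega

/-- a barrier: closed pair with difference three -/
structure Bar (G : SimpleGraph V) [DecidableRel G.Adj] (X I : Finset V) : Prop extends CP G X I where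
  ne : I.Nonempty
  three : X.card = I.card + 3

lemma card_inter_add (A B : Finset V) : (A ∩ B).card + (A \ B).card = A.card := by
  rw [add_comm]; exact Finset.card_sdiff_add_card_inter A B

lemma block (H : Hyp G) {i : ℕ} (hmin : ∀ X I : Finset V, Bar G X I → i ≤ I.card)
    {X I X' I' : Finset V} (h : Bar G X I) (h' : Bar G X' I') (hi : I.card = i) (hi' : I'.card = i) :
    I = I' ∨ Disjoint I I' := by
  by_cases hdis : Disjoint I I'
  · exact Or.inr hdis
  left
  have hc := h.toCP.compl3 H h.three
  have hc' := h'.toCP.compl3 H h'.three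
  obtain ⟨t, htI, htI'⟩ := Finset.not_disjoint_iff.1 hdis
  have htX : t ∉ X := fun hx => Finset.disjoint_left.1 h.disj hx htI
  have htX' : t ∉ X' := fun hx => Finset.disjoint_left.1 h'.disj hx htI'
  have W : ∀ {X I X' I' : Finset V}, Bar G X I → Bar G X' I' → CP G (X \ I') (I \ X') := by
    intro X I X' I' h h'
    refine ⟨⟨?_, ?_⟩, CP.mono_ind h.ind Finset.sdiff_subset⟩
    · exact Finset.disjoint_of_subset_left Finset.sdiff_subset
        (Finset.disjoint_of_subset_right Finset.sdiff_subset h.disj)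
    · intro u hu v huv
      rw [Finset.mem_sdiff] at hu ⊢
      exact ⟨h.nbr u hu.1 v huv, fun hv => hu.2 (h'.nbr v hv u huv.symm)⟩
  have sub : ∀ {X I A B : Finset V}, A ⊆ X → B ⊆ I → 3 ≤ (X ∪ I)ᶜ.card → 3 ≤ (A ∪ B)ᶜ.card := by
    intro X I A B hA hB h3
    exact h3.trans (Finset.card_le_card (Finset.compl_subset_compl.2 (Finset.union_subset_union hA hB)))
  have w1 := W h h'
  have w2 := W h' h
  have n1 : (I \ X').Nonempty := ⟨t, by simp [htI, htX']⟩
  have n2 : (I' \ X).Nonempty := ⟨t, by simp [htI', htX]⟩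
  have d1 := w1.diff H n1 (sub Finset.sdiff_subset Finset.sdiff_subset hc)
  have d2 := w2.diff H n2 (sub Finset.sdiff_subset Finset.sdiff_subset hc')
  have c1 := card_inter_add X I'
  have c2 := card_inter_add I X'
  have c3 := card_inter_add X' I
  have c4 := card_inter_add I' X
  rw [Finset.inter_comm X' I] at c3
  rw [Finset.inter_comm I' X] at c4
  have t1 := h.three
  have t2 := h'.three
  have m1 := hmin _ _ ⟨w1, n1, by omega⟩
  have a0 : (X ∩ I').card = 0 := by omega
  have b0 : (I ∩ X').card = 0 := by omega
  rw [Finset.card_eq_zero] at a0 b0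
  -- aligned case
  have u1 : CP G (X ∩ X') (I ∩ I') := by
    refine ⟨⟨?_, ?_⟩, CP.mono_ind h.ind Finset.inter_subset_left⟩
    · exact Finset.disjoint_of_subset_left Finset.inter_subset_left
        (Finset.disjoint_of_subset_right Finset.inter_subset_left h.disj)
    · intro u hu v huv
      rw [Finset.mem_inter] at hu ⊢
      exact ⟨h.nbr u hu.1 v huv, h'.nbr u hu.2 v huv⟩
  have n3 : (I ∩ I').Nonempty := ⟨t, by simp [htI, htI']⟩
  have d3 := u1.diff H n3 (sub Finset.inter_subset_left Finset.inter_subset_left hc)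
  by_cases heq : (X ∩ X').card = (I ∩ I').card + 3
  · have m2 := hmin _ _ ⟨u1, n3, heq⟩
    have e1 : I ∩ I' = I := Finset.eq_of_subset_of_card_le Finset.inter_subset_left (by omega)
    have e2 : I ∩ I' = I' := Finset.eq_of_subset_of_card_le Finset.inter_subset_right (by omega)
    rw [← e1]; exact e2
  · exfalso
    have u2 : NC G (X ∪ X') (I ∪ I') := by
      refine ⟨?_, ?_⟩
      · rw [Finset.disjoint_union_left, Finset.disjoint_union_right, Finset.disjoint_union_right]
        refine ⟨⟨h.disj, ?_⟩, ?_, h'.disj⟩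
        · exact Finset.disjoint_iff_inter_eq_empty.2 a0
        · exact (Finset.disjoint_iff_inter_eq_empty.2 b0).symm
      · intro u hu v huv
        rw [Finset.mem_union] at hu ⊢
        exact hu.imp (fun hu => h.nbr u hu v huv) (fun hu => h'.nbr u hu v huv)
    have s1 := Finset.card_union_add_card_inter X X'
    have s2 := Finset.card_union_add_card_inter I I'
    have s3 := u2.bd H.reg
    have s4 := u2.M2
    have s5 := bd_eq H.reg ((X ∪ X') ∪ (I ∪ I'))ᶜ
    rw [bd_compl] at s5
    have s6 := ec_self_le (G := G) ((X ∪ X') ∪ (I ∪ I'))ᶜ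
    have s7 : X.card ≤ ((X ∪ X') ∪ (I ∪ I')).card :=
      Finset.card_le_card (Finset.subset_union_left.trans Finset.subset_union_left)
    have s8 := h.toNC.card5 H.reg h.ne
    have s9 : ((X ∪ X') ∪ (I ∪ I'))ᶜ.card ≤ 2 := by
      by_contra hlt
      have := b3 H ((X ∪ X') ∪ (I ∪ I')) (by omega) (by omega)
      omega
    apply nb_lemma H (X ∪ X')
    generalize ((X ∪ X') ∪ (I ∪ I'))ᶜ.card = z at *
    interval_cases z <;> omega

lemma NC.map (φ : G ≃g G) {X I : Finset V} (h : NC G X I) :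
    NC G (X.map φ.toEquiv.toEmbedding) (I.map φ.toEquiv.toEmbedding) := by
  refine ⟨(Finset.disjoint_map _).2 h.disj, ?_⟩
  intro u hu v huv
  rw [Finset.mem_map] at hu
  obtain ⟨a, ha, rfl⟩ := hu
  obtain ⟨b, rfl⟩ := φ.surjective v
  rw [mem_map_iso]
  exact h.nbr a ha b (φ.map_adj_iff.1 huv)

lemma Bar.map (φ : G ≃g G) {X I : Finset V} (h : Bar G X I) :
    Bar G (X.map φ.toEquiv.toEmbedding) (I.map φ.toEquiv.toEmbedding) :=
  ⟨⟨h.toNC.map φ, by rw [ec_map]; exact h.ind⟩, by simpa using h.ne, by simpa using h.three⟩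

/-- neighbourhood of a set -/
def Nb (G : SimpleGraph V) [DecidableRel G.Adj] (I : Finset V) : Finset V :=
  Finset.univ.filter fun v => ∃ u ∈ I, G.Adj u v

lemma Bar.Nb_eq (H : Hyp G) {X I : Finset V} (h : Bar G X I) : Nb G I = X := by
  have hsub : Nb G I ⊆ X := by
    intro v hv
    simp only [Nb, Finset.mem_filter, Finset.mem_univ, true_and] at hv
    obtain ⟨u, hu, huv⟩ := hv
    exact h.nbr u hu v huv
  have hcp : CP G (Nb G I) I := by
    refine ⟨⟨Finset.disjoint_of_subset_left hsub h.disj, ?_⟩, CP.mono_ind h.ind hsub⟩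
    intro u hu v huv
    simp only [Nb, Finset.mem_filter, Finset.mem_univ, true_and]
    exact ⟨u, hu, huv⟩
  have hc := h.toCP.compl3 H h.three
  have := hcp.diff H h.ne (hc.trans (Finset.card_le_card (Finset.compl_subset_compl.2
    (Finset.union_subset_union hsub (Finset.Subset.refl _)))))
  exact Finset.eq_of_subset_of_card_le hsub (by have := h.three; omega)

lemma Nb_map (φ : G ≃g G) (I : Finset V) (v : V) :
    φ v ∈ Nb G (I.map φ.toEquiv.toEmbedding) ↔ v ∈ Nb G I := by
  simp only [Nb, Finset.mem_filter, Finset.mem_univ, true_and]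
  constructor
  · rintro ⟨u, hu, huv⟩
    rw [Finset.mem_map] at hu
    obtain ⟨a, ha, rfl⟩ := hu
    exact ⟨a, ha, φ.map_adj_iff.1 huv⟩
  · rintro ⟨u, hu, huv⟩
    exact ⟨φ u, (mem_map_iso φ I u).2 hu, φ.map_adj_iff.2 huv⟩

lemma no_bar (H : Hyp G) {X₀ I₀ : Finset V} (h₀ : Bar G X₀ I₀) : False := by
  classical
  obtain ⟨I, hI, hmin'⟩ := Finset.exists_min_image
    (Finset.univ.filter fun I : Finset V => ∃ X, Bar G X I) Finset.card
    ⟨I₀, by simp only [Finset.mem_filter, Finset.mem_univ, true_and]; exact ⟨X₀, h₀⟩⟩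
  simp only [Finset.mem_filter, Finset.mem_univ, true_and] at hI hmin'
  obtain ⟨X, h⟩ := hI
  have hmin : ∀ X' I' : Finset V, Bar G X' I' → I.card ≤ I'.card := fun X' I' h' => hmin' I' ⟨X', h'⟩
  clear hmin' h₀ X₀ I₀
  set B : Finset (Finset V) :=
    Finset.univ.filter fun J => J.card = I.card ∧ ∃ Y, Bar G Y J with hB
  have memB : ∀ J, J ∈ B ↔ J.card = I.card ∧ ∃ Y, Bar G Y J := by
    intro J; simp [hB]
  have mapB : ∀ (φ : G ≃g G) J, J ∈ B → J.map φ.toEquiv.toEmbedding ∈ B := by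
    intro φ J hJ
    rw [memB] at hJ ⊢
    obtain ⟨h1, Y, h2⟩ := hJ
    exact ⟨by rw [Finset.card_map]; exact h1, _, h2.map φ⟩
  have hIB : I ∈ B := (memB I).2 ⟨rfl, X, h⟩
  -- each vertex is in exactly one block
  have one : ∀ v : V, (B.filter fun J => v ∈ J).card = 1 := by
    intro v
    rw [Finset.card_eq_one]
    obtain ⟨u, hu⟩ := h.ne
    obtain ⟨φ, hφ⟩ := H.vt u v
    refine ⟨I.map φ.toEquiv.toEmbedding, ?_⟩
    have hv : v ∈ I.map φ.toEquiv.toEmbedding := by rw [← hφ, mem_map_iso]; exact hu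
    have hJB := mapB φ I hIB
    ext J
    rw [Finset.mem_filter, Finset.mem_singleton]
    constructor
    · rintro ⟨h1, h2⟩
      obtain ⟨e1, Y1, b1⟩ := (memB _).1 h1
      obtain ⟨e2, Y2, b2⟩ := (memB _).1 hJB
      rcases block H hmin b1 b2 e1 e2 with h3 | h3
      · exact h3
      · exact absurd hv (Finset.disjoint_left.1 h3 h2)
    · rintro rfl
      exact ⟨hJB, hv⟩
  have count1 : Fintype.card V = B.card * I.card := by
    have h1 : ∑ v : V, (B.filter fun J => v ∈ J).card = ∑ J ∈ B, J.card := by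
      simp only [Finset.card_filter]
      rw [Finset.sum_comm]
      refine Finset.sum_congr rfl fun J _ => ?_
      rw [← Finset.card_filter]; simp
    rw [Finset.sum_congr rfl fun v _ => one v,
      Finset.sum_congr rfl fun J hJ => ((memB J).1 hJ).1] at h1
    simpa using h1
  obtain ⟨v₀⟩ := H.conn.nonempty
  have const : ∀ u v : V, (B.filter fun J => u ∈ Nb G J).card ≤ (B.filter fun J => v ∈ Nb G J).card := by
    intro u v
    obtain ⟨φ, hφ⟩ := H.vt u v
    refine Finset.card_le_card_of_injOn (fun J => J.map φ.toEquiv.toEmbedding) ?_ ?_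
    · intro J hJ
      simp only [Finset.coe_filter, Set.mem_ofPred_eq] at hJ ⊢
      exact ⟨mapB φ J hJ.1, by rw [← hφ, Nb_map]; exact hJ.2⟩
    · intro J _ J' _ hJJ
      exact Finset.map_injective _ hJJ
  set ρ := (B.filter fun J => v₀ ∈ Nb G J).card with hρ
  have count2 : Fintype.card V * ρ = B.card * (I.card + 3) := by
    have h1 : ∑ v : V, (B.filter fun J => v ∈ Nb G J).card = ∑ J ∈ B, (Nb G J).card := by
      simp only [Finset.card_filter]
      rw [Finset.sum_comm]
      refine Finset.sum_congr rfl fun J _ => ?_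
      rw [← Finset.card_filter]; simp
    have h2 : ∑ J ∈ B, (Nb G J).card = B.card * (I.card + 3) := by
      rw [← smul_eq_mul, ← Finset.sum_const]
      refine Finset.sum_congr rfl fun J hJ => ?_
      obtain ⟨e1, Y, b⟩ := (memB J).1 hJ
      rw [b.Nb_eq H, b.three, e1]
    rw [Finset.sum_congr rfl fun v _ => le_antisymm (const v v₀) (const v₀ v), h2] at h1
    simpa using h1
  have hBpos : 0 < B.card := Finset.card_pos.2 ⟨I, hIB⟩
  have h3 : I.card * ρ = I.card + 3 := by
    rw [count1, mul_assoc] at count2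
    exact Nat.eq_of_mul_eq_mul_left hBpos count2
  have hdvd : I.card ∣ 3 := (Nat.dvd_add_right (dvd_refl I.card)).1 ⟨ρ, h3.symm⟩
  have hX5 := h.toNC.card5 H.reg h.ne
  have ht := h.three
  have hI3 : I.card = 3 := by
    rcases (Nat.dvd_prime Nat.prime_three).1 hdvd with h4 | h4 <;> omega
  have hIX := h.toNC.ecIX H.reg
  obtain ⟨x, hx, hx2⟩ : ∃ x ∈ X, ec G {x} I ≤ 2 := by
    by_contra hcon
    push Not at hcon
    have : ∑ _x ∈ X, 3 ≤ ∑ x ∈ X, ec G {x} I := Finset.sum_le_sum fun x hx => hcon x hx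
    rw [← ec_eq_sum, ec_comm, Finset.sum_const, smul_eq_mul] at this
    omega
  have hd : Disjoint (X.erase x) I := Finset.disjoint_of_subset_left (Finset.erase_subset _ _) h.disj
  have hcard : ((X.erase x) ∪ I).card = 8 := by
    rw [Finset.card_union_of_disjoint hd, Finset.card_erase_of_mem hx]; omega
  have e1 : ec G X I = ec G {x} I + ec G (X.erase x) I := by
    rw [← ec_union_left G I (by simp), ← Finset.insert_eq, Finset.insert_erase hx]
  have e2 := bd_eq H.reg ((X.erase x) ∪ I)
  rw [ec_union_left _ _ hd, ec_union_right _ _ hd, ec_union_right _ _ hd, h.toNC.ecII,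
    CP.mono_ind h.ind (Finset.erase_subset _ _), ec_comm G I (X.erase x), hcard] at e2
  have e3 := card_compl_add ((X.erase x) ∪ I)
  have e4 := H.n16
  have e5 := H.b8 ((X.erase x) ∪ I) (by omega) (by omega)
  rw [ec_comm] at hIX
  omega

end CPs

section Final

variable {V : Type*} [Fintype V] [DecidableEq V] {G : SimpleGraph V} [DecidableRel G.Adj]

/-- a family of odd components of `G - X` -/
structure Fam (G : SimpleGraph V) (X : Finset V) (F : Finset (Finset V)) : Prop where
  odd : ∀ C ∈ F, Odd C.card
  disjX : ∀ C ∈ F, Disjoint C X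
  pw : ∀ C ∈ F, ∀ D ∈ F, C ≠ D → Disjoint C D
  nbr : ∀ C ∈ F, ∀ u ∈ C, ∀ v, G.Adj u v → v ∈ C ∨ v ∈ X

lemma comps {W : Type*} [Finite W] (K : SimpleGraph W) (f : W → V) (hf : Function.Injective f)
    (hadj : ∀ a b, G.Adj (f a) (f b) → K.Adj a b) :
    ∃ X F, Fam G X F ∧ X.card + Nat.card W = Fintype.card V ∧ F.card = K.oddComponents.ncard := by
  classical
  have := Fintype.ofFinite W
  let g : K.ConnectedComponent → Finset V := fun c => c.supp.toFinset.image f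
  have memg : ∀ c a, f a ∈ g c ↔ K.connectedComponentMk a = c := by
    intro c a
    simp only [g, Finset.mem_image, Set.mem_toFinset, ConnectedComponent.mem_supp_iff]
    constructor
    · rintro ⟨b, hb, hab⟩
      rw [← hf hab]; exact hb
    · intro h
      exact ⟨a, h, rfl⟩
  have formg : ∀ c v, v ∈ g c → ∃ a, f a = v ∧ K.connectedComponentMk a = c := by
    intro c v hv
    simp only [g, Finset.mem_image, Set.mem_toFinset, ConnectedComponent.mem_supp_iff] at hv
    obtain ⟨a, h1, h2⟩ := hv
    exact ⟨a, h2, h1⟩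
  have hg : Function.Injective g := by
    intro c d hcd
    obtain ⟨a, ha⟩ := c.exists_rep
    have h1 : f a ∈ g c := (memg c a).2 ha
    rw [hcd] at h1
    exact ha.symm.trans ((memg d a).1 h1)
  refine ⟨(Finset.univ.image f)ᶜ, K.oddComponents.toFinset.image g, ⟨?_, ?_, ?_, ?_⟩, ?_, ?_⟩
  · intro C hC
    rw [Finset.mem_image] at hC
    obtain ⟨c, hc, rfl⟩ := hC
    rw [Set.mem_toFinset] at hc
    rw [Finset.card_image_of_injective _ hf, ← Set.ncard_eq_toFinset_card']
    exact hc
  · intro C hC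
    rw [Finset.mem_image] at hC
    obtain ⟨c, hc, rfl⟩ := hC
    rw [Finset.disjoint_left]
    intro v hv hv2
    obtain ⟨a, rfl, -⟩ := formg c v hv
    exact (Finset.mem_compl.1 hv2) (Finset.mem_image_of_mem f (Finset.mem_univ a))
  · intro C hC D hD hne
    rw [Finset.mem_image] at hC hD
    obtain ⟨c, hc, rfl⟩ := hC
    obtain ⟨d, hd, rfl⟩ := hD
    rw [Finset.disjoint_left]
    intro v hv hv2
    obtain ⟨a, rfl, h1⟩ := formg c v hv
    exact hne (by rw [← h1, ← (memg d a).1 hv2])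
  · intro C hC u hu v huv
    rw [Finset.mem_image] at hC
    obtain ⟨c, hc, rfl⟩ := hC
    by_cases hv : v ∈ Finset.univ.image f
    · left
      rw [Finset.mem_image] at hv
      obtain ⟨b, -, rfl⟩ := hv
      obtain ⟨a, rfl, h1⟩ := formg c u hu
      rw [memg, ← h1]
      exact (ConnectedComponent.connectedComponentMk_eq_of_adj (hadj a b huv)).symm
    · right
      exact Finset.mem_compl.2 hv
  · rw [← card_compl_add (Finset.univ.image f), Finset.card_image_of_injective _ hf,
      Nat.card_eq_fintype_card, Finset.card_univ]
    omega
  · rw [Finset.card_image_of_injective _ hg, ← Set.ncard_eq_toFinset_card']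

lemma exists_fam (heven : Even (Fintype.card V)) (hnfc : ¬ PFactorCritical G 4) :
    ∃ X F, Fam G X F ∧ 4 ≤ X.card ∧ X.card ≤ F.card + 2 := by
  unfold PFactorCritical at hnfc
  push Not at hnfc
  obtain ⟨X0, hX0, hno⟩ := hnfc
  have hno2 : ¬ ∃ M : (G.induce X0ᶜ).Subgraph, M.IsPerfectMatching := fun ⟨M, hM⟩ => hno M hM
  rw [SimpleGraph.tutte] at hno2
  push Not at hno2
  obtain ⟨u, hu⟩ := hno2
  unfold IsTutteViolator at hu
  set K := ((⊤ : (G.induce X0ᶜ).Subgraph).deleteVerts u).coe with hK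
  obtain ⟨X, F, hF, h1, h2⟩ := comps (G := G) K (fun a => (a.1.1 : V))
    (fun a b hab => Subtype.ext (Subtype.ext hab))
    (by
      intro a b hab
      have ha := a.2
      have hb := b.2
      simp only [Subgraph.deleteVerts_verts] at ha hb
      rw [hK, Subgraph.coe_adj, Subgraph.deleteVerts_adj]
      exact ⟨trivial, ha.2, trivial, hb.2, hab⟩)
  refine ⟨X, F, hF, ?_⟩
  have h3 : Nat.card ((⊤ : (G.induce X0ᶜ).Subgraph).deleteVerts u).verts + u.ncard + 4
      = Fintype.card V := by
    have e1 : ((⊤ : (G.induce X0ᶜ).Subgraph).deleteVerts u).verts = uᶜ := by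
      rw [Subgraph.deleteVerts_verts, Subgraph.verts_top]; exact (Set.compl_eq_univ_sdiff u).symm
    have e2 : Nat.card (X0ᶜ : Set V) = (X0ᶜ).ncard := rfl
    rw [e1]
    have e3 : Nat.card (uᶜ : Set _) = (uᶜ).ncard := rfl
    have e4 := Set.ncard_add_ncard_compl u
    have e5 := Set.ncard_add_ncard_compl X0
    rw [Nat.card_eq_fintype_card (α := V)] at e5
    omega
  have h4 := odd_ncard_oddComponents (G := K)
  rw [← h2] at h4 hu
  have h5 : Odd F.card ↔ Odd X.card := by
    rw [h4]
    have : Nat.card ((⊤ : (G.induce X0ᶜ).Subgraph).deleteVerts u).verts = Fintype.card V - X.card := by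
      omega
    rw [this]
    have hle : X.card ≤ Fintype.card V := by omega
    rw [Nat.odd_sub hle]
    rw [← Nat.not_even_iff_odd (n := Fintype.card V)]
    rw [← Nat.not_even_iff_odd (n := X.card)]
    tauto
  rw [Nat.odd_iff, Nat.odd_iff] at h5
  omega

lemma Fam.ecX {X : Finset V} {F : Finset (Finset V)} (h : Fam G X F) {C : Finset V} (hC : C ∈ F) :
    ec G C X = bd G C := by
  have hsub : X ⊆ Cᶜ := fun x hx => Finset.mem_compl.2 fun hxC =>
    Finset.disjoint_left.1 (h.disjX C hC) hxC hx
  have h0 : ec G C (Cᶜ \ X) = 0 := by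
    rw [ec_eq_zero]
    intro a ha b hb hab
    rw [Finset.mem_sdiff, Finset.mem_compl] at hb
    have := h.nbr C hC a ha b hab
    tauto
  unfold bd
  rw [ec_split X C Cᶜ hsub, h0, add_zero]

lemma Fam.sum (hreg : G.IsRegularOfDegree 5) {X : Finset V} {F : Finset (Finset V)}
    (h : Fam G X F) :
    ∑ C ∈ F, bd G C + bd G (X ∪ F.biUnion id)ᶜ + ec G X X = 5 * X.card := by
  set U := F.biUnion id with hU
  have hXU : Disjoint X U := by
    rw [hU, Finset.disjoint_biUnion_right]
    intro C hC
    exact (h.disjX C hC).symm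
  have h1 : ec G U X = ∑ C ∈ F, bd G C := by
    rw [← Finset.sum_congr rfl fun C hC => h.ecX hC]
    unfold ec
    rw [hU, Finset.sum_biUnion]
    · rfl
    · intro C hC D hD hne
      exact h.pw C hC D hD hne
  have h2 := ec_compl hreg X (X ∪ U)
  rw [ec_union_right _ _ hXU, ec_comm G X U, h1] at h2
  have h3 : ec G (X ∪ U)ᶜ U = 0 := by
    rw [ec_eq_zero]
    intro a ha b hb hab
    rw [hU, Finset.mem_biUnion] at hb
    obtain ⟨C, hC, hb⟩ := hb
    rw [Finset.mem_compl, Finset.mem_union] at ha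
    rcases h.nbr C hC b hb a hab.symm with h4 | h4
    · exact ha (Or.inr (Finset.mem_biUnion.2 ⟨C, hC, h4⟩))
    · exact ha (Or.inl h4)
  have h4 : bd G (X ∪ U)ᶜ = ec G X (X ∪ U)ᶜ := by
    unfold bd
    rw [compl_compl, ec_union_right _ _ hXU, h3, ec_comm]
    rfl
  omega

lemma Fam.nc {X : Finset V} {F : Finset (Finset V)} (h : Fam G X F) :
    NC G X ((F.filter fun C => C.card = 1).biUnion id) := by
  refine ⟨?_, ?_⟩
  · rw [Finset.disjoint_biUnion_right]
    intro C hC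
    exact (h.disjX C (Finset.mem_filter.1 hC).1).symm
  · intro u hu v huv
    rw [Finset.mem_biUnion] at hu
    obtain ⟨C, hC, hu⟩ := hu
    rw [Finset.mem_filter] at hC
    rcases h.nbr C hC.1 u hu v huv with h4 | h4
    · obtain ⟨x, hx⟩ := Finset.card_eq_one.1 hC.2
      rw [id, hx, Finset.mem_singleton] at hu
      rw [hx, Finset.mem_singleton] at h4
      rw [hu, h4] at huv
      exact absurd huv (G.irrefl)
    · exact h4

lemma Fam.cardI {X : Finset V} {F : Finset (Finset V)} (h : Fam G X F) :
    ((F.filter fun C => C.card = 1).biUnion id).card = (F.filter fun C => C.card = 1).card := by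
  rw [Finset.card_biUnion, Finset.card_eq_sum_ones]
  · exact Finset.sum_congr rfl fun C hC => (Finset.mem_filter.1 hC).2
  · intro C hC D hD hne
    exact h.pw C (Finset.mem_filter.1 hC).1 D (Finset.mem_filter.1 hD).1 hne

lemma prop_aux {c x i c1 c2 : Prop} (e1 : c ↔ ¬ x ∧ ¬ i) (e2 : c ↔ c1 ∨ c2) (e3 : c1 → ¬ c2) :
    ¬ ((x ∨ c2) ∨ i) ↔ c1 := by
  tauto

/-- exactly one nontrivial component -/
lemma one_big (H : Hyp G) {X I C : Finset V} (h : NC G X I) (hI : I.Nonempty)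
    (hC : (X ∪ I)ᶜ = C) (h3 : X.card = I.card + 3) (hodd : Odd C.card) (hC3 : 3 ≤ C.card) :
    False := by
  have h5 := h.card5 H.reg hI
  have hb := h.bd H.reg
  have hM := h.M2
  rw [← bd_compl] at hb
  rw [hC] at hb hM
  have hcc : (X ∪ I).card = X.card + I.card := Finset.card_union_of_disjoint h.disj
  have hcc2 : Cᶜ.card = X.card + I.card := by rw [← hC, compl_compl, hcc]
  have hbe := bd_eq H.reg C
  obtain ⟨k, hk⟩ := ec_self_even (G := G) C
  obtain ⟨l, hl⟩ := hodd
  have hb11 := b3 H C hC3 (by omega)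
  by_cases h15 : ec G X X = 0
  · exact no_bar H ⟨⟨h, h15⟩, hI, h3⟩
  have hlt : C.card < 6 := by
    by_contra hlt
    have := H.b6 C (by omega) (by omega)
    omega
  obtain hc | hc : C.card = 3 ∨ C.card = 5 := by omega
  · exact nb_lemma H X (by omega)
  obtain ⟨-, -, h13, -⟩ := small_bd H.reg H.tri C (by omega) (by omega)
  have h13 := h13 hc
  obtain ⟨j, hj⟩ := ec_self_even (G := G) X
  obtain ⟨p, hp, hp1, -, -⟩ := mantel H.tri C (Finset.card_pos.1 (by omega))
  set C1 := G.neighborFinset p ∩ C with hC1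
  have hd1 : ec G {p} C = C1.card := ec_singleton G p C
  have hpC1 : p ∉ C1 := by simp [hC1]
  have hsub : C1 ⊆ C := Finset.inter_subset_right
  set C2 := C \ C1 with hC2
  have hpC2 : p ∈ C2 := Finset.mem_sdiff.2 ⟨hp, hpC1⟩
  have hcard : C2.card + C1.card = C.card := Finset.card_sdiff_add_card_eq_card hsub
  have hpos : 1 ≤ C2.card := Finset.card_pos.2 ⟨p, hpC2⟩
  have i1 : ec G C1 C1 = 0 :=
    ec_nbr_self H.tri p C1 C1 Finset.inter_subset_left Finset.inter_subset_left
  have hd : Disjoint C1 C2 := Finset.disjoint_sdiff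
  have hCu : C = C1 ∪ C2 := (Finset.union_sdiff_of_subset hsub).symm
  have hCC : ec G C C = 2 * ec G C1 C2 + ec G C2 C2 := by
    conv_lhs => rw [hCu]
    rw [ec_union_left _ _ hd, ec_union_right _ _ hd, ec_union_right _ _ hd, i1, ec_comm G C2 C1]
    ring
  have hm := ec_le_mul G C1 C2
  have hs := ec_self_le (G := G) C2
  have h12 : ec G C C = 12 := by omega
  have hd3 : 3 ≤ C1.card := by rw [hc, h12, hd1] at hp1; omega
  have hd4 : C1.card = 3 := by
    by_contra hne
    have a1 : C1.card = 4 := by omega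
    have a2 : C2.card = 1 := by omega
    rw [a1, a2] at hm
    rw [a2] at hs
    omega
  have hc2 : C2.card = 2 := by omega
  have i2 : ec G C2 C2 = 0 := by
    obtain ⟨r, hr⟩ : ∃ r, C2.erase p = {r} := Finset.card_eq_one.1 (by
      rw [Finset.card_erase_of_mem hpC2]; omega)
    have hC2e : C2 = {p} ∪ {r} := by
      rw [← hr, ← Finset.insert_eq, Finset.insert_erase hpC2]
    have hrC2 : r ∈ C2 := by rw [hC2e]; simp
    have hpr : ¬ G.Adj p r := by
      intro hadj
      rw [hC2, Finset.mem_sdiff] at hrC2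
      exact hrC2.2 (Finset.mem_inter.2 ⟨by simpa using hadj, hrC2.1⟩)
    rw [ec_eq_zero]
    intro a ha b hb hab
    rw [hC2e] at ha hb
    simp only [Finset.mem_union, Finset.mem_singleton] at ha hb
    rcases ha with rfl | rfl <;> rcases hb with rfl | rfl
    · exact G.irrefl hab
    · exact hpr hab
    · exact hpr hab.symm
    · exact G.irrefl hab
  have hXC : Disjoint X C := by
    rw [← hC, Finset.disjoint_left]
    intro x hx hx2
    exact (Finset.mem_compl.1 hx2) (Finset.mem_union_left _ hx)
  have hIC : Disjoint I C := by
    rw [← hC, Finset.disjoint_left]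
    intro x hx hx2
    exact (Finset.mem_compl.1 hx2) (Finset.mem_union_right _ hx)
  have hC2s : C2 ⊆ C := Finset.sdiff_subset
  have hXC2 : Disjoint X C2 := Finset.disjoint_of_subset_right hC2s hXC
  have hnc : NC G (X ∪ C2) I := by
    refine ⟨Finset.disjoint_union_left.2 ⟨h.disj, (Finset.disjoint_of_subset_right hC2s hIC).symm⟩, ?_⟩
    intro u hu v huv
    exact Finset.mem_union_left _ (h.nbr u hu v huv)
  have hcomp : (X ∪ C2 ∪ I)ᶜ = C1 := by
    ext x
    have e1 : x ∈ C ↔ x ∉ X ∧ x ∉ I := by rw [← hC]; simp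
    have e2 : x ∈ C ↔ x ∈ C1 ∨ x ∈ C2 := by rw [← Finset.mem_union, ← hCu]
    have e3 : x ∈ C1 → x ∉ C2 := fun hx => Finset.disjoint_left.1 hd hx
    simp only [Finset.mem_compl, Finset.mem_union]
    exact prop_aux e1 e2 e3
  have hM2 := hnc.M2
  rw [hcomp, i1, ec_union_left _ _ hXC2, ec_union_right _ _ hXC2, ec_union_right _ _ hXC2, i2,
    ec_comm G C2 X] at hM2
  have hXC2e : ec G X C2 ≤ 4 := by
    have e1 := ec_compl H.reg C2 C
    have e2 : ec G C2 C = ec G C1 C2 := by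
      conv_lhs => rw [hCu]
      rw [ec_union_right _ _ hd, i2, ec_comm]
      rfl
    have e3 : ec G C2 X ≤ ec G C2 Cᶜ := ec_mono G (Finset.Subset.refl _) (fun x hx =>
      Finset.mem_compl.2 (Finset.disjoint_left.1 hXC hx))
    rw [ec_comm]
    omega
  exact nb_lemma H (X ∪ C2) (by omega)

lemma main (H : Hyp G) (heven : Even (Fintype.card V)) (hnfc : ¬ PFactorCritical G 4) : False := by
  obtain ⟨X, F, h, hX4, hXF⟩ := exists_fam heven hnfc
  have hnc := h.nc
  have hcI := h.cardI
  have hsum := h.sum H.reg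
  set T := F.filter fun C => C.card = 1 with hT
  set N := F.filter fun C => ¬ C.card = 1 with hN
  set I := T.biUnion id with hI
  have hTN : T.card + N.card = F.card := Finset.card_filter_add_card_filter_not _
  have hle : ∀ C ∈ F, X.card ≤ Cᶜ.card := fun C hC => Finset.card_le_card fun x hx =>
    Finset.mem_compl.2 fun hxC => Finset.disjoint_left.1 (h.disjX C hC) hxC hx
  have hT5 : ∑ C ∈ T, bd G C = 5 * T.card := by
    rw [mul_comm, ← smul_eq_mul, ← Finset.sum_const]
    refine Finset.sum_congr rfl fun C hC => ?_
    have e1 := bd_eq H.reg C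
    have e2 := ec_self_le (G := G) C
    rw [(Finset.mem_filter.1 hC).2] at e1 e2
    omega
  have hN3 : ∀ C ∈ N, 3 ≤ C.card := by
    intro C hC
    rw [hN, Finset.mem_filter] at hC
    obtain ⟨k, hk⟩ := h.odd C hC.1
    have := hC.2
    omega
  have hN11 : ∀ C ∈ N, 11 ≤ bd G C := by
    intro C hC
    have := hle C (Finset.mem_filter.1 hC).1
    exact b3 H C (hN3 C hC) (by omega)
  have hNs : 11 * N.card ≤ ∑ C ∈ N, bd G C := by
    rw [mul_comm, ← smul_eq_mul, ← Finset.sum_const]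
    exact Finset.sum_le_sum hN11
  have hsplit : ∑ C ∈ T, bd G C + ∑ C ∈ N, bd G C = ∑ C ∈ F, bd G C :=
    Finset.sum_filter_add_sum_filter_not _ _ _
  have hN1 : N.card ≤ 1 := by omega
  have hIne : I.Nonempty := by
    rw [← Finset.card_pos]
    omega
  have hX5 := hnc.card5 H.reg hIne
  obtain hN0 | hN1 : N.card = 0 ∨ N.card = 1 := by omega
  · have s3 := hnc.bd H.reg
    have s4 := hnc.M2
    have s5 := bd_eq H.reg (X ∪ I)ᶜ
    rw [bd_compl] at s5
    have s7 : X.card ≤ (X ∪ I).card := Finset.card_le_card Finset.subset_union_left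
    have s9 : (X ∪ I)ᶜ.card ≤ 2 := by
      by_contra hlt
      have := b3 H (X ∪ I) (by omega) (by omega)
      omega
    have s6 := ec_self_le (G := G) (X ∪ I)ᶜ
    apply nb_lemma H X
    generalize (X ∪ I)ᶜ.card = z at *
    interval_cases z <;> omega
  · obtain ⟨C, hC⟩ := Finset.card_eq_one.1 hN1
    have hCN : C ∈ N := by rw [hC]; simp
    have hCF := (Finset.mem_filter.1 hCN).1
    have hb := hN11 C hCN
    rw [hC, Finset.sum_singleton] at hsplit
    have hR : (X ∪ F.biUnion id)ᶜ = ∅ := by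
      by_contra hne
      have e1 : 1 ≤ (X ∪ F.biUnion id)ᶜ.card :=
        Finset.card_pos.2 (Finset.nonempty_iff_ne_empty.2 hne)
      have e2 : X.card ≤ (X ∪ F.biUnion id)ᶜᶜ.card := by
        rw [compl_compl]; exact Finset.card_le_card Finset.subset_union_left
      have := b1 H (X ∪ F.biUnion id)ᶜ e1 (by omega)
      omega
    have hFe : F = T ∪ {C} := by
      rw [← hC]; exact (Finset.filter_union_filter_not_eq _ _).symm
    have hcomp : (X ∪ I)ᶜ = C := by
      ext x
      have hx : x ∈ X ∪ F.biUnion id := by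
        by_contra hx
        have : x ∈ (X ∪ F.biUnion id)ᶜ := Finset.mem_compl.2 hx
        rw [hR] at this
        simp at this
      rw [hFe, Finset.union_biUnion, Finset.singleton_biUnion, id, Finset.mem_union,
        Finset.mem_union] at hx
      rw [Finset.mem_compl, Finset.mem_union]
      constructor
      · intro hx2
        tauto
      · rintro hxC (hx2 | hx2)
        · exact Finset.disjoint_left.1 (h.disjX C hCF) hxC hx2
        · rw [hI, Finset.mem_biUnion] at hx2
          obtain ⟨D, hD, hxD⟩ := hx2
          have hD2 := Finset.mem_filter.1 hD
          have hne : C ≠ D := by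
            rintro rfl
            have := hN3 C hCN
            omega
          exact Finset.disjoint_left.1 (h.pw C hCF D hD2.1 hne) hxC hxD
    exact one_big H hnc hIne hcomp (by omega) (h.odd C hCF) (hN3 C hCN)

end Final

end FC

/-- (Lemma 3.8) `G` connected vertex-transitive non-bipartite
triangle-free of degree 5 and even order, not 4-factor-critical, with
`λ₆(G) ≥ 14` and `λ₈(G) = 15`. Then every `λ₈`-atom `S` satisfies `|S| ≥ 15`. -/
theorem statement16 {V : Type*} [Fintype V] [DecidableEq V]
    (G : SimpleGraph V) [DecidableRel G.Adj]
    (hconn : G.Connected) (hvt : VertexTransitive G) (hnb : ¬ G.Colorable 2)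
    (htri : G.CliqueFree 3) (hreg : G.IsRegularOfDegree 5)
    (heven : Even (Fintype.card V)) (hnfc : ¬ PFactorCritical G 4)
    (h6 : 14 ≤ lambdaS G 6) (h8 : lambdaS G 8 = 15)
    (S : Set V) (hS : IsLambdaAtom G 8 S) :
    15 ≤ S.ncard := by
  exact (FC.main (FC.hyp_of hconn hvt hnb htri hreg h6 h8 S hS) heven hnfc).elim
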